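/- arXiv:1910.03294 — 4 statements merged into one kernel-verified Lean document; each statement's English description precedes it below -/
import Mathlib

section
/- Let d ≥ 1, let E = EuclideanSpace ℝ (Fin d), and let η₁ ∈ (0,1), κ₄ ∈ (0,1), ε > 0, κ₂ > 0, κ₃ > 0; set κ₅ = (1−η₁)·κ₄·ε/(1+κ₂+κ₃). Suppose F : E → ℝ is twice continuously differentiable with ‖D²F(y)‖ ≤ κ₂ for all y ∈ E, x ∈ E, g = ∇F(x) with ‖g‖ ≥ ε, A : E →L[ℝ] E with ‖A‖ ≤ κ₃, and m(p) = F(x) + ⟪g, p⟫ + (1/2)⟪p, A p⟫. If Δ > 0, ‖d‖ ≤ Δ, the Cauchy decrease condition m(0) − m(d) ≥ κ₄·‖g‖·min(‖g‖/(1+‖A‖), Δ) holds, and ‖d‖ ≤ κ₅, then m(0) − m(d) > 0 and F(x) − F(x + d) ≥ η₁·(m(0) − m(d)); equivalently, the reduction ratio ρ(d) = (F(x) − F(x+d))/(m(0) − m(d)) satisfies ρ(d) ≥ η₁. -/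
open RealInnerProductSpace

/-- First-order Taylor estimate for a `C²` function with bounded second derivative. -/
theorem norm_sub_sub_fderiv_le_of_norm_iteratedFDeriv_two_le
    {E G : Type*} [NormedAddCommGroup E] [NormedSpace ℝ E]
    [NormedAddCommGroup G] [NormedSpace ℝ G] {f : E → G} (hf : ContDiff ℝ 2 f) {C : ℝ}
    (hC : ∀ y, ‖iteratedFDeriv ℝ 2 f y‖ ≤ C) (x s : E) :
    ‖f (x + s) - f x - fderiv ℝ f x s‖ ≤ C * ‖s‖ ^ 2 := by
  have hC0 : 0 ≤ C := (norm_nonneg _).trans (hC x)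
  have hf' : Differentiable ℝ (fderiv ℝ f) :=
    (hf.fderiv_right (m := 1) (by norm_num)).differentiable one_ne_zero
  have hlip (y : E) : ‖fderiv ℝ f y - fderiv ℝ f x‖ ≤ C * ‖y - x‖ := by
    refine convex_univ.norm_image_sub_le_of_norm_fderiv_le (𝕜 := ℝ)
      (fun z _ => hf' z) (fun z _ => ?_) (Set.mem_univ x) (Set.mem_univ y)
    rw [← norm_iteratedFDeriv_one, norm_iteratedFDeriv_fderiv]
    exact hC z
  have h := (convex_closedBall x ‖s‖).norm_image_sub_le_of_norm_fderiv_le' (𝕜 := ℝ)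
    (f := f) (φ := fderiv ℝ f x) (C := C * ‖s‖) (x := x) (y := x + s)
    (fun z _ => hf.differentiable two_ne_zero z)
    (fun z hz => (hlip z).trans
      (mul_le_mul_of_nonneg_left (mem_closedBall_iff_norm.mp hz) hC0))
    (Metric.mem_closedBall_self (norm_nonneg s)) (by simp)
  simpa [pow_two, mul_assoc] using h

/-- Theorem 1 of the paper: if the trial step is small enough (`‖d‖ ≤ κ₅`), then the
model decrease is positive, the actual decrease is at least `η₁` times the predicted
decrease, and consequently the reduction ratio satisfies `ρ(d) ≥ η₁`. -/
theorem accepted_if_small_step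
    (d : ℕ) (hd : 1 ≤ d)
    (η₁ κ₄ ε κ₂ κ₃ κ₅ : ℝ)
    (hη₁ : η₁ ∈ Set.Ioo (0 : ℝ) 1) (hκ₄ : κ₄ ∈ Set.Ioo (0 : ℝ) 1)
    (hε : 0 < ε) (hκ₂ : 0 < κ₂) (hκ₃ : 0 < κ₃)
    (hκ₅ : κ₅ = (1 - η₁) * κ₄ * ε / (1 + κ₂ + κ₃))
    (F : EuclideanSpace ℝ (Fin d) → ℝ) (hF : ContDiff ℝ 2 F)
    (hF2 : ∀ y : EuclideanSpace ℝ (Fin d), ‖iteratedFDeriv ℝ 2 F y‖ ≤ κ₂)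
    (x : EuclideanSpace ℝ (Fin d))
    (g : EuclideanSpace ℝ (Fin d)) (hg : g = gradient F x) (hgε : ‖g‖ ≥ ε)
    (A : EuclideanSpace ℝ (Fin d) →L[ℝ] EuclideanSpace ℝ (Fin d)) (hA : ‖A‖ ≤ κ₃)
    (m : EuclideanSpace ℝ (Fin d) → ℝ)
    (hm : ∀ p : EuclideanSpace ℝ (Fin d), m p = F x + ⟪g, p⟫ + (1 / 2) * ⟪p, A p⟫)
    (Δ : ℝ) (hΔ : 0 < Δ)
    (step : EuclideanSpace ℝ (Fin d)) (hstepΔ : ‖step‖ ≤ Δ)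
    (hCauchy : m 0 - m step ≥ κ₄ * ‖g‖ * min (‖g‖ / (1 + ‖A‖)) Δ)
    (hsmall : ‖step‖ ≤ κ₅) :
    0 < m 0 - m step ∧
      F x - F (x + step) ≥ η₁ * (m 0 - m step) ∧
      (F x - F (x + step)) / (m 0 - m step) ≥ η₁ := by
  obtain ⟨hη0, hη1⟩ := hη₁
  have hκ₄0 : 0 < κ₄ := hκ₄.1
  have hg0 : 0 < ‖g‖ := hε.trans_le hgε
  have hpos : 0 < m 0 - m step := lt_of_lt_of_le (by positivity) hCauchy
  have hκ₅mul : κ₅ * (1 + κ₂ + κ₃) = (1 - η₁) * κ₄ * ε := by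
    rw [hκ₅]
    field_simp
  have hs0 : 0 ≤ ‖step‖ := norm_nonneg step
  have hκ₅0 : 0 ≤ κ₅ := hs0.trans hsmall
  have hprod : (1 - η₁) * κ₄ ≤ 1 := by nlinarith [hκ₄.2]
  have hκ₅le : κ₅ ≤ ‖g‖ / (1 + ‖A‖) := by
    rw [le_div_iff₀ (by positivity)]
    calc κ₅ * (1 + ‖A‖) ≤ κ₅ * (1 + κ₂ + κ₃) := by gcongr; linarith
      _ = (1 - η₁) * κ₄ * ε := hκ₅mul
      _ ≤ 1 * ε := by gcongr
      _ ≤ ‖g‖ := by linarith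
  have hdecr : κ₄ * ε * ‖step‖ ≤ m 0 - m step :=
    calc κ₄ * ε * ‖step‖ ≤ κ₄ * ‖g‖ * min (‖g‖ / (1 + ‖A‖)) Δ := by
          gcongr
          exact le_min (hsmall.trans hκ₅le) hstepΔ
      _ ≤ m 0 - m step := hCauchy
  have hgrad : fderiv ℝ F x step = ⟪g, step⟫ := by
    rw [hg, inner_gradient_left]
  have htaylor := norm_sub_sub_fderiv_le_of_norm_iteratedFDeriv_two_le hF hF2 x step
  rw [hgrad, Real.norm_eq_abs] at htaylor
  have hquad : |⟪step, A step⟫| ≤ κ₃ * ‖step‖ ^ 2 :=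
    calc |⟪step, A step⟫| ≤ ‖step‖ * ‖A step‖ := abs_real_inner_le_norm _ _
      _ ≤ ‖step‖ * (κ₃ * ‖step‖) := by gcongr; exact A.le_of_opNorm_le hA step
      _ = κ₃ * ‖step‖ ^ 2 := by ring
  have hmodel : m 0 - m step = -⟪g, step⟫ - 1 / 2 * ⟪step, A step⟫ := by
    rw [hm, hm]
    simp only [inner_zero_right, inner_zero_left]
    ring
  have herr : (κ₂ + κ₃) * ‖step‖ ^ 2 ≤ (1 - η₁) * (m 0 - m step) :=
    calc (κ₂ + κ₃) * ‖step‖ ^ 2 ≤ (1 + κ₂ + κ₃) * (κ₅ * ‖step‖) := by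
          rw [pow_two]
          gcongr
          linarith
      _ = (1 - η₁) * (κ₄ * ε * ‖step‖) := by linear_combination ‖step‖ * hκ₅mul
      _ ≤ (1 - η₁) * (m 0 - m step) :=
          mul_le_mul_of_nonneg_left hdecr (by linarith)
  have hred : η₁ * (m 0 - m step) ≤ F x - F (x + step) := by
    have hκ₃s : 0 ≤ κ₃ * ‖step‖ ^ 2 := by positivity
    linarith [(abs_le.mp htaylor).2, (abs_le.mp hquad).1]
  exact ⟨hpos, hred, (le_div_iff₀ hpos).mpr hred⟩
end

section
/- Let d ≥ 1, let E = EuclideanSpace ℝ (Fin d), and let κ₄ ∈ (0,1), ε > 0, κ₂ > 0, κ₃ > 0. Suppose F : E → ℝ is twice continuously differentiable with ‖D²F(y)‖ ≤ κ₂ for all y ∈ E, x ∈ E, g = ∇F(x) with ‖g‖ ≥ ε, A : E →L[ℝ] E with ‖A‖ ≤ κ₃, and m(p) = F(x) + ⟪g, p⟫ + (1/2)⟪p, A p⟫. If Δ > 0, ‖d‖ ≤ Δ, ‖d‖ ≤ ε/(1+κ₃), and the Cauchy decrease condition m(0) − m(d) ≥ κ₄·‖g‖·min(‖g‖/(1+‖A‖),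 Δ) holds, then F(x) − F(x + d) ≥ (1 − ((κ₂+κ₃)/(κ₄·ε))·‖d‖)·(m(0) − m(d)). -/
open RealInnerProductSpace

/-- First-order Taylor estimate with a globally bounded second derivative. -/
theorem norm_image_add_sub_sub_fderiv_le {V W : Type*} [NormedAddCommGroup V] [NormedSpace ℝ V]
    [NormedAddCommGroup W] [NormedSpace ℝ W] {f : V → W} {C : ℝ} (hf : ContDiff ℝ 2 f)
    (hC : ∀ y, ‖iteratedFDeriv ℝ 2 f y‖ ≤ C) (x v : V) :
    ‖f (x + v) - f x - fderiv ℝ f x v‖ ≤ C * ‖v‖ ^ 2 := by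
  have hC0 : 0 ≤ C := (norm_nonneg _).trans (hC x)
  have hdiff : Differentiable ℝ f := hf.differentiable (by norm_num)
  have hdiff' : Differentiable ℝ (fderiv ℝ f) :=
    (hf.fderiv_right (m := 1) (by norm_num)).differentiable (by norm_num)
  have hbound : ∀ y, ‖fderiv ℝ (fderiv ℝ f) y‖ ≤ C := fun y => by
    rw [← norm_iteratedFDeriv_one, norm_iteratedFDeriv_fderiv]
    exact hC y
  have hlip : ∀ y ∈ Metric.closedBall x ‖v‖, ‖fderiv ℝ f y - fderiv ℝ f x‖ ≤ C * ‖v‖ := by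
    intro y hy
    refine (convex_univ.norm_image_sub_le_of_norm_fderiv_le (fun z _ => hdiff' z)
      (fun z _ => hbound z) (Set.mem_univ x) (Set.mem_univ y)).trans ?_
    exact mul_le_mul_of_nonneg_left (mem_closedBall_iff_norm.mp hy) hC0
  have h := (convex_closedBall x ‖v‖).norm_image_sub_le_of_norm_fderiv_le' (fun z _ => hdiff z)
    hlip (Metric.mem_closedBall_self (norm_nonneg v)) (y := x + v) (by simp)
  rw [add_sub_cancel_left] at h
  rwa [sq, ← mul_assoc]

/-- Quantitative lower bound on the actual reduction: under the Cauchy decrease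
condition and a smallness assumption on the step, the actual reduction is at least
`(1 - ((κ₂ + κ₃)/(κ₄ ε)) ‖d‖)` times the predicted reduction. -/
theorem actual_reduction_lower_bound
    (d : ℕ) (hd : 1 ≤ d)
    (κ₄ ε κ₂ κ₃ : ℝ)
    (hκ₄ : κ₄ ∈ Set.Ioo (0 : ℝ) 1)
    (hε : 0 < ε) (hκ₂ : 0 < κ₂) (hκ₃ : 0 < κ₃)
    (F : EuclideanSpace ℝ (Fin d) → ℝ) (hF : ContDiff ℝ 2 F)
    (hF2 : ∀ y : EuclideanSpace ℝ (Fin d), ‖iteratedFDeriv ℝ 2 F y‖ ≤ κ₂)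
    (x : EuclideanSpace ℝ (Fin d))
    (g : EuclideanSpace ℝ (Fin d)) (hg : g = gradient F x) (hgε : ‖g‖ ≥ ε)
    (A : EuclideanSpace ℝ (Fin d) →L[ℝ] EuclideanSpace ℝ (Fin d)) (hA : ‖A‖ ≤ κ₃)
    (m : EuclideanSpace ℝ (Fin d) → ℝ)
    (hm : ∀ p : EuclideanSpace ℝ (Fin d), m p = F x + ⟪g, p⟫ + (1 / 2) * ⟪p, A p⟫)
    (Δ : ℝ) (hΔ : 0 < Δ)
    (step : EuclideanSpace ℝ (Fin d)) (hstepΔ : ‖step‖ ≤ Δ)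
    (hstepε : ‖step‖ ≤ ε / (1 + κ₃))
    (hCauchy : m 0 - m step ≥ κ₄ * ‖g‖ * min (‖g‖ / (1 + ‖A‖)) Δ) :
    F x - F (x + step) ≥ (1 - (κ₂ + κ₃) / (κ₄ * ε) * ‖step‖) * (m 0 - m step) := by
  have hκ₄0 : 0 < κ₄ := hκ₄.1
  have hgrad : fderiv ℝ F x step = ⟪g, step⟫ := by
    rw [hg, inner_gradient_left]
  have htaylor := norm_image_add_sub_sub_fderiv_le hF hF2 x step
  rw [hgrad, Real.norm_eq_abs] at htaylor
  have hquad : |⟪step, A step⟫| ≤ κ₃ * ‖step‖ ^ 2 := by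
    calc |⟪step, A step⟫| ≤ ‖step‖ * ‖A step‖ := abs_real_inner_le_norm _ _
      _ ≤ ‖step‖ * (κ₃ * ‖step‖) := by gcongr; exact A.le_of_opNorm_le hA step
      _ = κ₃ * ‖step‖ ^ 2 := by ring
  have hpred : κ₄ * ε * ‖step‖ ≤ m 0 - m step := by
    refine le_trans ?_ hCauchy
    have hmin : ‖step‖ ≤ min (‖g‖ / (1 + ‖A‖)) Δ :=
      le_min (hstepε.trans (by gcongr)) hstepΔ
    gcongr
  have hm0 : m 0 = F x := by simp [hm]
  have hmodel : (κ₂ + κ₃) * ‖step‖ ^ 2 ≤ (κ₂ + κ₃) / (κ₄ * ε) * ‖step‖ * (m 0 - m step) := by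
    calc (κ₂ + κ₃) * ‖step‖ ^ 2
        = (κ₂ + κ₃) / (κ₄ * ε) * ‖step‖ * (κ₄ * ε * ‖step‖) := by field_simp
      _ ≤ _ := by gcongr
  have hms := hm step
  have hκ₃sq : 0 ≤ κ₃ * ‖step‖ ^ 2 := by positivity
  linarith [le_abs_self (F (x + step) - F x - ⟪g, step⟫), neg_abs_le ⟪step, A step⟫]
end

section
/- Let d ≥ 1, let E = EuclideanSpace ℝ (Fin d), let n ≥ 1 be a natural number, let κ₁ ∈ ℝ and c > 0. Let F : E → ℝ satisfy F(z) ≥ κ₁ for all z ∈ E, let (x^ν)_{ν ∈ ℕ} be a sequence in E, and let (s^ν)_{ν ∈ ℕ} be a sequence of natural numbers with 1 ≤ s^ν ≤ n for all ν. Assume: (i) for every ν with s^ν < n, F(x^{ν+1}) ≤ F(x^ν) and moreover either s^{ν+1} ≥ s^ν + 1 or F(x^ν) − F(x^{ν+1}) ≥ c; (ii) for every ν with s^ν = n, s^{ν+1} = n. Then there exists ν₀ ∈ ℕ such that s^ν = n for all ν ≥ ν₀. -/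
/-- A real sequence that is bounded below cannot decrease by a fixed positive amount
at every step. -/
theorem exists_sub_lt_succ_of_bddBelow {u : ℕ → ℝ} {b c : ℝ} (hc : 0 < c)
    (hb : ∀ k, b ≤ u k) : ∃ k, u k - c < u (k + 1) := by
  by_contra! h
  have hu : ∀ k : ℕ, u k ≤ u 0 - k * c := by
    intro k
    induction k with
    | zero => simp
    | succ k ih =>
      have := h k
      push_cast
      linarith
  obtain ⟨k, hk⟩ := exists_nat_gt ((u 0 - b) / c)
  rw [div_lt_iff₀ hc] at hk
  linarith [hu k, hb k]

/-- Theorem 4 of the paper (abstract version): in the adaptive sample size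
trust-region method, the sample size eventually reaches the full batch size `n`
and stays there. -/
theorem sample_size_reaches_full_batch
    (d : ℕ) (hd : 1 ≤ d)
    (n : ℕ) (hn : 1 ≤ n)
    (κ₁ c : ℝ) (hc : 0 < c)
    (F : EuclideanSpace ℝ (Fin d) → ℝ)
    (hF : ∀ z : EuclideanSpace ℝ (Fin d), F z ≥ κ₁)
    (x : ℕ → EuclideanSpace ℝ (Fin d))
    (s : ℕ → ℕ) (hs : ∀ ν : ℕ, 1 ≤ s ν ∧ s ν ≤ n)
    (hlt : ∀ ν : ℕ, s ν < n →
      F (x (ν + 1)) ≤ F (x ν) ∧ (s (ν + 1) ≥ s ν + 1 ∨ F (x ν) - F (x (ν + 1)) ≥ c))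
    (heq : ∀ ν : ℕ, s ν = n → s (ν + 1) = n) :
    ∃ ν₀ : ℕ, ∀ ν ≥ ν₀, s ν = n := by
  obtain ⟨ν₀, hν₀⟩ : ∃ ν₀, s ν₀ = n := by
    by_contra! hne
    have hsn : ∀ ν, (s ν : ℝ) ≤ n := fun ν => by exact_mod_cast (hs ν).2
    have hn0 : (0 : ℝ) ≤ n := n.cast_nonneg
    -- The potential `n * F (x ν) - c * s ν` decreases by at least `c` at every step.
    obtain ⟨ν, hν⟩ := exists_sub_lt_succ_of_bddBelow
      (u := fun ν => n * F (x ν) - c * s ν) (b := n * κ₁ - c * n) hc fun ν =>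
        sub_le_sub (mul_le_mul_of_nonneg_left (hF _) hn0)
          (mul_le_mul_of_nonneg_left (hsn ν) hc.le)
    obtain ⟨hF_le, hs_inc | hF_dec⟩ := hlt ν (lt_of_le_of_ne (hs ν).2 (hne ν))
    · have hs_inc' : (s ν : ℝ) + 1 ≤ s (ν + 1) := by exact_mod_cast hs_inc
      have h1 := mul_le_mul_of_nonneg_left hF_le hn0
      have h2 := mul_le_mul_of_nonneg_left hs_inc' hc.le
      linarith
    · have hs_pos : (1 : ℝ) ≤ s (ν + 1) := by exact_mod_cast (hs (ν + 1)).1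
      have h1 := mul_le_mul_of_nonneg_left hF_dec hn0
      have h2 := mul_le_mul_of_nonneg_left hs_pos hc.le
      have h3 := mul_le_mul_of_nonneg_left (hsn ν) hc.le
      linarith
  exact ⟨ν₀, fun ν hν => Nat.le_induction hν₀ (fun k _ hk => heq k hk) ν hν⟩
end

section
/- Let d ≥ 1, let E = EuclideanSpace ℝ (Fin d), and let η₁ ∈ (0,1), κ₄ ∈ (0,1), ε > 0, κ₃ > 0, Δ_min > 0, and R, R̂ ∈ ℕ with 1 ≤ R ≤ R̂. For each k ∈ Fin R let b_k ∈ ℝ, and assume that for each k either (a) b_k = 0, or (b) there exist a function F_k : E → ℝ, points x_k ∈ E, vectors g_k ∈ E with ‖g_k‖ ≥ ε, operators A_k : E →L[ℝ] E with ‖A_k‖ ≤ κ₃, steps d_k ∈ E and radii Δ_k ≥ Δ_min such that, for the model m_k(p) = F_k(x_k) + ⟪g_k, p⟫ + (1/2)⟪p, A_k p⟫, the Cauchy decrease condition m_k(0) − m_k(d_k) ≥ κ₄·‖g_k‖·min(‖g_k‖/(1+‖A_k‖), Δ_k) holds, the acceptance condition F_k(x_k) − F_k(x_k + d_k) ≥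 η₁·(m_k(0) − m_k(d_k)) holds, and b_k = F_k(x_k) − F_k(x_k + d_k). Then the average b = (1/R)·∑_k b_k satisfies either b = 0 or b ≥ κ₇, where κ₇ = (η₁·κ₄·ε/R̂)·min(ε/(1+κ₃), Δ_min) > 0. -/
open RealInnerProductSpace

/-- Monotonicity of the Cauchy decrease bound in the gradient norm, the curvature bound and the
trust-region radius. -/
theorem cauchy_bound_mono {κ ε κ₃ Δmin γ α Δ : ℝ} (hκ : 0 ≤ κ) (hε : 0 ≤ ε) (hΔmin : 0 ≤ Δmin)
    (hγ : ε ≤ γ) (hα₀ : 0 ≤ α) (hα : α ≤ κ₃) (hΔ : Δmin ≤ Δ) :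
    κ * ε * min (ε / (1 + κ₃)) Δmin ≤ κ * γ * min (γ / (1 + α)) Δ := by
  have hγ₀ : 0 ≤ γ := hε.trans hγ
  have hκ₃ : 0 ≤ κ₃ := hα₀.trans hα
  have hmin : 0 ≤ min (ε / (1 + κ₃)) Δmin := le_min (by positivity) hΔmin
  gcongr

/-- If finitely many reals are each zero or at least `c ≥ 0`, then their average is zero or at
least `c / N`, for every `N` bounding their number. -/
theorem average_eq_zero_or_div_le {R N : ℕ} (hR : 1 ≤ R) (hRN : R ≤ N) {c : ℝ} (hc : 0 ≤ c)
    {b : Fin R → ℝ} (hb : ∀ k, b k = 0 ∨ c ≤ b k) :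
    (1 / (R : ℝ)) * ∑ k, b k = 0 ∨ c / N ≤ (1 / (R : ℝ)) * ∑ k, b k := by
  by_cases h : ∀ k, b k = 0
  · exact Or.inl (by simp [h])
  · right
    push Not at h
    obtain ⟨k, hk⟩ := h
    have hnonneg : ∀ j, 0 ≤ b j := fun j => (hb j).elim (fun h => h.ge) hc.trans
    have hsum : c ≤ ∑ j, b j := ((hb k).resolve_left hk).trans
      (Finset.single_le_sum (fun j _ => hnonneg j) (Finset.mem_univ k))
    have hR₀ : (0 : ℝ) < R := by exact_mod_cast hR
    calc c / N ≤ (∑ j, b j) / R := div_le_div₀ (hc.trans hsum) hsum hR₀ (by exact_mod_cast hRN)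
      _ = (1 / (R : ℝ)) * ∑ j, b j := by ring

/-- Theorem 3 of the paper: each inner-iteration improvement `b k` is either zero
(no step taken) or the improvement of an accepted trust-region step with radius at
least `Δmin`; hence the average predicted improvement is either zero or at least
`κ₇ = (η₁ κ₄ ε / R̂) · min (ε/(1+κ₃)) Δmin`. -/
theorem predicted_improvement_zero_or_bounded
    (d : ℕ) (hd : 1 ≤ d)
    (η₁ κ₄ ε κ₃ Δmin : ℝ)
    (hη₁ : η₁ ∈ Set.Ioo (0 : ℝ) 1) (hκ₄ : κ₄ ∈ Set.Ioo (0 : ℝ) 1)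
    (hε : 0 < ε) (hκ₃ : 0 < κ₃) (hΔmin : 0 < Δmin)
    (R Rhat : ℕ) (hR : 1 ≤ R) (hRRhat : R ≤ Rhat)
    (b : Fin R → ℝ)
    (hb : ∀ k : Fin R, b k = 0 ∨
      ∃ (F : EuclideanSpace ℝ (Fin d) → ℝ)
        (x g step : EuclideanSpace ℝ (Fin d))
        (A : EuclideanSpace ℝ (Fin d) →L[ℝ] EuclideanSpace ℝ (Fin d))
        (Δ : ℝ),
        ‖g‖ ≥ ε ∧ ‖A‖ ≤ κ₃ ∧ Δ ≥ Δmin ∧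
        (let m : EuclideanSpace ℝ (Fin d) → ℝ :=
          fun p => F x + ⟪g, p⟫ + (1 / 2) * ⟪p, A p⟫
         m 0 - m step ≥ κ₄ * ‖g‖ * min (‖g‖ / (1 + ‖A‖)) Δ ∧
         F x - F (x + step) ≥ η₁ * (m 0 - m step)) ∧
        b k = F x - F (x + step)) :
    (1 / (R : ℝ)) * ∑ k : Fin R, b k = 0 ∨
      (1 / (R : ℝ)) * ∑ k : Fin R, b k ≥
        η₁ * κ₄ * ε / (Rhat : ℝ) * min (ε / (1 + κ₃)) Δmin := by
  obtain ⟨hη₀, -⟩ := hη₁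
  obtain ⟨hκ₀, -⟩ := hκ₄
  have hmin : 0 < min (ε / (1 + κ₃)) Δmin := lt_min (by positivity) hΔmin
  have hstep : ∀ k, b k = 0 ∨ η₁ * (κ₄ * ε * min (ε / (1 + κ₃)) Δmin) ≤ b k := by
    intro k
    refine (hb k).imp_right ?_
    rintro ⟨F, x, g, step, A, Δ, hg, hA, hΔ, ⟨hcauchy, haccept⟩, hbk⟩
    rw [hbk]
    exact (mul_le_mul_of_nonneg_left ((cauchy_bound_mono hκ₀.le hε.le hΔmin.le hg
      (norm_nonneg A) hA hΔ).trans hcauchy) hη₀.le).trans haccept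
  refine (average_eq_zero_or_div_le hR hRRhat (by positivity) hstep).imp_right fun h => ?_
  calc η₁ * κ₄ * ε / (Rhat : ℝ) * min (ε / (1 + κ₃)) Δmin
      = η₁ * (κ₄ * ε * min (ε / (1 + κ₃)) Δmin) / Rhat := by ring
    _ ≤ (1 / (R : ℝ)) * ∑ k : Fin R, b k := h
end
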